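/- arXiv:2402.04375 — 3 statements merged into one kernel-verified Lean document; each statement's English description precedes it below -/
import Mathlib

section
/- There exists an absolute constant C > 0 such that the following holds. Let m, n ≥ 1 and d ≥ 2 be integers with d ≤ m+1 and |Q^m_{≤d}| ≤ m^d, let λ > 0, ε ∈ (0,1), δ ∈ (0,1), let τ > 0 with τ·√m ≥ 1, let l = max_{1≤j≤m+1} |Ω_j|, and set σ = 2·m^{d/2}·√(ln(1.25/δ))/ε. Consider the mechanism Gen_{d,σ} that, on input a dataset D_r of size n over m+1 attributes, draws independent Z_q[t] ∼ N(0,σ²) for q ∈ Q^m_{≤d}, t ∈ Ω_q, sets ĥ_q = M_q(D_r) + Z_q, and outputs (via a fixed measurable selection) a dataset D_s of size n over the same domains minimizing max_{q∈Q^m_{≤d}} ‖ĥ_q − M_q(D)‖₁ over all datasets D of size n. Then: (a) Gen_{d,σ} is (ε,δ)-differentially private; and (b) with probability at least 1 − 2^{−λ} over the noise, |L̂(w_s,D_r) − L̂(w_r,D_r)| ≤ C·( τ²·m/(d−1) + (1/n)·τ·√m·(3m·max{1,τ})^{d−1}·2·l^d·√(2·(ln(2)·(1+λ) + d·ln(m·l)))·σ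 ), where w_r minimizes the logistic risk L̂(·,D_r) and w_s minimizes L̂(·,D_s) over the ball {w ∈ ℝ^m : ‖w‖₂ ≤ τ}. -/
noncomputable section
open Finset MeasureTheory ProbabilityTheory Real

def ValidDomains (m : ℕ) (Ω : Fin (m+1) → Finset ℝ) : Prop :=
  (∀ j, (Ω j : Set ℝ) ⊆ Set.Icc (-1 : ℝ) 1) ∧ Ω (Fin.last m) = ({-1, 1} : Finset ℝ)

def ValidDataset {m n : ℕ} (Ω : Fin (m+1) → Finset ℝ) (D : Fin n → Fin (m+1) → ℝ) : Prop :=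
  ∀ i j, D i j ∈ Ω j

def marginal {m n : ℕ} (D : Fin n → Fin (m+1) → ℝ) (q : Finset (Fin (m+1)))
    (t : ∀ j ∈ q, ℝ) : ℝ :=
  Nat.card {i : Fin n // ∀ j (h : j ∈ q), D i j = t j h}

def margL1 {m n : ℕ} (Ω : Fin (m+1) → Finset ℝ) (Dr Ds : Fin n → Fin (m+1) → ℝ)
    (q : Finset (Fin (m+1))) : ℝ :=
  ∑ t ∈ q.pi Ω, |marginal Dr q t - marginal Ds q t|

def margin {m : ℕ} (w : EuclideanSpace ℝ (Fin m)) (v : Fin (m+1) → ℝ) : ℝ :=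
  (∑ j : Fin m, w j * v j.castSucc) * v (Fin.last m)

def risk {m n : ℕ} (φ : ℝ → ℝ) (w : EuclideanSpace ℝ (Fin m))
    (D : Fin n → Fin (m+1) → ℝ) : ℝ :=
  (1 / n) * ∑ i, φ (margin w (D i))

def logisticLoss (z : ℝ) : ℝ := Real.log (1 + Real.exp (-z))

def MargIdx (m d : ℕ) (Ω : Fin (m+1) → Finset ℝ) : Type :=
  Σ q : {q : Finset (Fin (m+1)) // q.Nonempty ∧ q.card ≤ d},
    {t : ∀ j ∈ (q : Finset (Fin (m+1))), ℝ // t ∈ (q : Finset (Fin (m+1))).pi Ω}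

instance (m d : ℕ) (Ω : Fin (m+1) → Finset ℝ) : Fintype (MargIdx m d Ω) := by
  unfold MargIdx; infer_instance

def Adjacent {m n : ℕ} (D D' : Fin n → Fin (m+1) → ℝ) : Prop :=
  ∃ i₀ : Fin n, (∀ i : Fin n, i ≠ i₀ → D i = D' i) ∧ D i₀ ≠ D' i₀

def noiseMeasure (m d : ℕ) (Ω : Fin (m+1) → Finset ℝ) (σ : ℝ) :
    Measure (MargIdx m d Ω → ℝ) :=
  Measure.pi fun _ => gaussianReal 0 (Real.toNNReal (σ ^ 2))

def margVec {m n d : ℕ} (Ω : Fin (m+1) → Finset ℝ) (D : Fin n → Fin (m+1) → ℝ)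
    (p : MargIdx m d Ω) : ℝ :=
  marginal D (p.1 : Finset (Fin (m+1))) p.2.1

def maxDistToMarginals {m n d : ℕ} (Ω : Fin (m+1) → Finset ℝ)
    (h : MargIdx m d Ω → ℝ) (D : Fin n → Fin (m+1) → ℝ) : ℝ :=
  sSup {r : ℝ | ∃ q : {q : Finset (Fin (m+1)) // q.Nonempty ∧ q.card ≤ d},
    r = ∑ t ∈ ((q : Finset (Fin (m+1))).pi Ω).attach,
      |h ⟨q, t⟩ - marginal D (q : Finset (Fin (m+1))) t.1|}

open scoped NNReal ENNReal

lemma gaussianReal_eq_withDensity_gaussianReal_zero (e : ℝ) {v : ℝ≥0} (hv : v ≠ 0) :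
    gaussianReal e v = (gaussianReal 0 v).withDensity
      (fun z => ENNReal.ofReal (exp ((z * e - e ^ 2 / 2) / v))) := by
  have hv' : (v : ℝ) ≠ 0 := by exact_mod_cast hv
  rw [gaussianReal_of_var_ne_zero _ hv, gaussianReal_of_var_ne_zero _ hv, ← withDensity_mul]
  · congr 1
    ext z
    rw [Pi.mul_apply, gaussianPDF, gaussianPDF, ← ENNReal.ofReal_mul (gaussianPDFReal_nonneg _ _ _)]
    congr 1
    rw [gaussianPDFReal, gaussianPDFReal, mul_assoc _ (exp _), ← exp_add]
    congr 2
    field_simp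
    ring
  · exact measurable_gaussianPDF _ _
  · fun_prop

lemma gaussianReal_Ioi_zero_le (v : ℝ≥0) :
    gaussianReal 0 v (Set.Ioi 0) ≤ ENNReal.ofReal (1 / 2) := by
  have h1 : gaussianReal 0 v (Set.Iio 0) = gaussianReal 0 v (Set.Ioi 0) := by
    have h : (gaussianReal 0 v).map (fun x => -x) = gaussianReal 0 v := by
      rw [gaussianReal_map_neg, neg_zero]
    rw [← h, Measure.map_apply (by fun_prop) measurableSet_Iio, h]
    congr 1
    ext x
    simp
  have h2 : gaussianReal 0 v (Set.Iio 0) + gaussianReal 0 v (Set.Ioi 0) ≤ 1 := by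
    rw [← measure_union _ measurableSet_Ioi]
    · exact prob_le_one
    · exact Set.disjoint_left.2 fun x hx hx' => lt_asymm (Set.mem_Iio.1 hx) hx'
  rw [h1, ← two_mul] at h2
  rw [one_div, ENNReal.ofReal_inv_of_pos two_pos, ENNReal.ofReal_ofNat, ← one_div,
    ENNReal.le_div_iff_mul_le (by simp) (by simp), mul_comm]
  exact h2

lemma gaussianReal_Ioi_le_exp {v : ℝ≥0} (hv : v ≠ 0) {T : ℝ} (hT : 0 ≤ T) :
    gaussianReal 0 v (Set.Ioi T) ≤ ENNReal.ofReal (1 / 2 * exp (-T ^ 2 / (2 * v))) := by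
  have hv' : (0 : ℝ) < v := by exact_mod_cast pos_iff_ne_zero.2 hv
  have h1 : gaussianReal 0 v (Set.Ioi T) = gaussianReal (-T) v (Set.Ioi 0) := by
    have h := gaussianReal_map_add_const (μ := 0) (v := v) (-T)
    rw [zero_add] at h
    rw [← h, Measure.map_apply (by fun_prop) measurableSet_Ioi]
    congr 1
    ext x
    simp
  rw [h1, gaussianReal_eq_withDensity_gaussianReal_zero _ hv, withDensity_apply _ measurableSet_Ioi]
  calc _ ≤ ∫⁻ z in Set.Ioi 0, ENNReal.ofReal (exp (-T ^ 2 / (2 * v))) ∂(gaussianReal 0 v) := by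
        refine setLIntegral_mono (by fun_prop) fun z hz => ?_
        refine ENNReal.ofReal_le_ofReal (exp_le_exp.2 ?_)
        rw [div_le_div_iff₀ hv' (by positivity)]
        have : 0 ≤ z * T * v := mul_nonneg (mul_nonneg (le_of_lt hz) hT) hv'.le
        nlinarith
    _ ≤ _ := by
        rw [setLIntegral_const, mul_comm, ENNReal.ofReal_mul (by norm_num)]
        gcongr
        exact gaussianReal_Ioi_zero_le v

lemma gaussianReal_Ioi_le_add (T : ℝ) (hT : T ≤ 0) :
    gaussianReal 0 1 (Set.Ioi T) ≤ ENNReal.ofReal (1 / 2 - T) := by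
  have h : Set.Ioi T = Set.Ioc T 0 ∪ Set.Ioi 0 := (Set.Ioc_union_Ioi_eq_Ioi hT).symm
  have h2 : gaussianReal 0 1 (Set.Ioc T 0) ≤ ENNReal.ofReal (-T) := by
    rw [gaussianReal_apply _ one_ne_zero]
    calc _ ≤ ∫⁻ x in Set.Ioc T 0, 1 := by
          refine lintegral_mono fun x => ?_
          rw [gaussianPDF, ← ENNReal.ofReal_one]
          refine ENNReal.ofReal_le_ofReal ?_
          rw [gaussianPDFReal]
          refine mul_le_one₀ ?_ (exp_pos _).le ?_
          · refine inv_le_one_of_one_le₀ ?_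
            rw [one_le_sqrt]
            have := pi_gt_three
            simp only [NNReal.coe_one, mul_one]
            linarith
          · rw [exp_le_one_iff, neg_div, neg_nonpos]
            positivity
      _ = _ := by simp
  calc _ ≤ ENNReal.ofReal (-T) + ENNReal.ofReal (1 / 2) := by
        rw [h]
        exact (measure_union_le _ _).trans (add_le_add h2 (gaussianReal_Ioi_zero_le 1))
    _ = _ := by
        rw [← ENNReal.ofReal_add (by linarith) (by norm_num)]
        congr 1
        ring

lemma log_five_fourths_div_pos {δ : ℝ} (hδ : δ ∈ Set.Ioo (0 : ℝ) 1) : 0 < log (1.25 / δ) := by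
  refine log_pos ?_
  rw [one_lt_div hδ.1]
  linarith [hδ.2]

/-- Tail estimate behind the calibration `c = √(2 ln(1.25/δ))` of the Gaussian mechanism. -/
lemma gaussianReal_Ioi_le_delta {δ c x : ℝ} (hδ : δ ∈ Set.Ioo (0 : ℝ) 1)
    (hc : c = √(2 * log (1.25 / δ))) (hx : c - 1 / (2 * c) ≤ x) :
    gaussianReal 0 1 (Set.Ioi x) ≤ ENNReal.ofReal δ := by
  obtain ⟨h0, h1⟩ := hδ
  have hL : 0.2 ≤ log (1.25 / δ) := by
    have h := one_sub_inv_le_log_of_pos (x := 1.25 / δ) (by positivity)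
    have : (1.25 / δ)⁻¹ = δ * 0.8 := by rw [inv_div]; ring
    rw [this] at h
    linarith
  have hc2 : c ^ 2 = 2 * log (1.25 / δ) := by rw [hc, sq_sqrt (by linarith)]
  have hc0 : 0.6 ≤ c := by
    rw [hc]
    exact le_sqrt_of_sq_le (by nlinarith)
  have hcpos : 0 < c := by linarith
  have hδ' : δ = 1.25 * exp (-c ^ 2 / 2) := by
    have : -c ^ 2 / 2 = -log (1.25 / δ) := by rw [hc2]; ring
    rw [this, exp_neg, exp_log (by positivity)]
    field_simp
  refine (measure_mono (Set.Ioi_subset_Ioi hx)).trans ?_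
  rcases le_total 0 (c - 1 / (2 * c)) with h | h
  · refine (gaussianReal_Ioi_le_exp one_ne_zero h).trans (ENNReal.ofReal_le_ofReal ?_)
    have hsq : (c - 1 / (2 * c)) ^ 2 ≥ c ^ 2 - 1 := by
      have : (c - 1 / (2 * c)) ^ 2 = c ^ 2 - 1 + (1 / (2 * c)) ^ 2 := by field_simp; ring
      rw [this]
      linarith [sq_nonneg (1 / (2 * c))]
    have he : exp (1 / 2) ≤ 2 := by
      have h2 : exp (1 / 2) ^ 2 = exp 1 := by rw [← exp_nat_mul]; norm_num
      nlinarith [exp_one_lt_d9, exp_pos (1 / 2 : ℝ)]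
    calc _ ≤ 1 / 2 * exp (1 / 2 + -c ^ 2 / 2) := by
          gcongr
          simp only [NNReal.coe_one]
          linarith
      _ ≤ 1.25 * exp (-c ^ 2 / 2) := by
          rw [exp_add]
          nlinarith [exp_pos (-c ^ 2 / 2)]
      _ = δ := hδ'.symm
  · refine (gaussianReal_Ioi_le_add _ h).trans (ENNReal.ofReal_le_ofReal ?_)
    have h3 : 2 * c ^ 2 ≤ 1 := by
      rw [sub_nonpos, le_div_iff₀ (by positivity)] at h
      linarith
    have h4 : 1 / (2 * c) - c ≤ 0.3 := by
      rw [sub_le_iff_le_add, div_le_iff₀ (by positivity)]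
      nlinarith
    have h5 := add_one_le_exp (-c ^ 2 / 2)
    rw [hδ']
    linarith

lemma pi_gaussianReal_eq_withDensity {ι : Type*} [Fintype ι] {v : ℝ≥0} (hv : v ≠ 0) (e : ι → ℝ) :
    Measure.pi (fun i => gaussianReal (e i) v) = (Measure.pi fun _ => gaussianReal 0 v).withDensity
      (fun z => ENNReal.ofReal (exp ((∑ i, z i * e i - (∑ i, e i ^ 2) / 2) / v))) := by
  have hf (i : ι) : Measurable fun x : ℝ => ENNReal.ofReal (exp ((x * e i - e i ^ 2 / 2) / v)) := by
    fun_prop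
  refine Measure.pi_eq fun s hs => ?_
  rw [withDensity_apply _ (MeasurableSet.univ_pi hs),
    ← lintegral_indicator (MeasurableSet.univ_pi hs)]
  have h1 : ∀ z : ι → ℝ, (Set.univ.pi s).indicator
      (fun z => ENNReal.ofReal (exp ((∑ i, z i * e i - (∑ i, e i ^ 2) / 2) / v))) z =
      ∏ i, (s i).indicator
        (fun x => ENNReal.ofReal (exp ((x * e i - e i ^ 2 / 2) / v))) (z i) := by
    intro z
    by_cases hz : z ∈ Set.univ.pi s
    · rw [Set.indicator_of_mem hz]
      rw [Finset.prod_congr rfl fun i _ => Set.indicator_of_mem (hz i (Set.mem_univ i)) _]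
      rw [← ENNReal.ofReal_prod_of_nonneg fun i _ => (exp_pos _).le, ← exp_sum]
      congr 2
      rw [← Finset.sum_div, Finset.sum_sub_distrib, Finset.sum_div]
    · rw [Set.indicator_of_notMem hz]
      simp only [Set.mem_pi, Set.mem_univ, true_implies, not_forall] at hz
      obtain ⟨i, hi⟩ := hz
      exact (Finset.prod_eq_zero (Finset.mem_univ i) (Set.indicator_of_notMem hi _)).symm
  simp_rw [h1]
  rw [lintegral_prod_eq_prod_lintegral_of_indepFun Finset.univ
    (fun i (z : ι → ℝ) => (s i).indicator
        (fun x => ENNReal.ofReal (exp ((x * e i - e i ^ 2 / 2) / v))) (z i))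
    (iIndepFun_pi fun i => ((hf i).indicator (hs i)).aemeasurable)
    fun i => ((hf i).indicator (hs i)).comp (measurable_pi_apply i)]
  refine Finset.prod_congr rfl fun i _ => ?_
  rw [gaussianReal_eq_withDensity_gaussianReal_zero (e i) hv, withDensity_apply _ (hs i),
    ← lintegral_indicator (hs i)]
  exact (measurePreserving_eval (fun _ : ι => gaussianReal 0 v) i).lintegral_comp
    ((hf i).indicator (hs i))

lemma map_sum_mul_pi_gaussianReal {ι : Type*} [Fintype ι] (v : ℝ≥0) (e : ι → ℝ) (s : ℝ≥0)
    (hs : (s : ℝ) = ∑ i, e i ^ 2) :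
    (Measure.pi fun _ : ι => gaussianReal 0 v).map (fun z => ∑ i, z i * e i) =
      gaussianReal 0 (s * v) := by
  have hm : Measurable fun z : ι → ℝ => ∑ i, z i * e i := by fun_prop
  have := Measure.isProbabilityMeasure_map (μ := Measure.pi fun _ : ι => gaussianReal 0 v)
    hm.aemeasurable
  refine Measure.ext_of_charFun ?_
  ext t
  rw [charFun_gaussianReal, charFun_apply_real, integral_map hm.aemeasurable (by fun_prop)]
  have h1 : ∀ z : ι → ℝ, Complex.exp (t * ((∑ i, z i * e i : ℝ) : ℂ) * Complex.I) =
      ∏ i, Complex.exp (((t * e i : ℝ) : ℂ) * (z i : ℂ) * Complex.I) := by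
    intro z
    rw [← Complex.exp_sum]
    congr 1
    push_cast
    rw [Finset.mul_sum, Finset.sum_mul]
    exact Finset.sum_congr rfl fun i _ => by ring
  simp_rw [h1]
  rw [integral_fintype_prod_eq_prod (𝕜 := ℂ)
    (f := fun i (x : ℝ) => Complex.exp (((t * e i : ℝ) : ℂ) * (x : ℂ) * Complex.I))]
  simp_rw [← charFun_apply_real, charFun_gaussianReal]
  rw [← Complex.exp_sum]
  congr 1
  have h2 : ((s : ℝ) : ℂ) = ∑ i, (e i : ℂ) ^ 2 := by rw [hs]; push_cast; rfl
  rw [NNReal.coe_mul, Complex.ofReal_mul, h2]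
  simp only [Complex.ofReal_zero, mul_zero, zero_mul, zero_sub, Finset.sum_neg_distrib,
    Complex.ofReal_mul]
  rw [Finset.sum_mul, Finset.sum_mul, Finset.sum_div]
  congr 1
  exact Finset.sum_congr rfl fun i _ => by ring

/-- The Gaussian mechanism: adding noise of standard deviation `σ = Δ√(2 ln(1.25/δ))/ε` to a vector
of `ℓ²`-sensitivity at most `Δ` is `(ε, δ)`-differentially private. -/
lemma gaussian_mechanism {ι : Type*} [Fintype ι] (a b : ι → ℝ) {ε δ Δ σ : ℝ}
    (hε : ε ∈ Set.Ioo (0 : ℝ) 1) (hδ : δ ∈ Set.Ioo (0 : ℝ) 1) (hΔ : 0 < Δ)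
    (hσ : σ = Δ * √(2 * log (1.25 / δ)) / ε) (hab : ∑ i, (a i - b i) ^ 2 ≤ Δ ^ 2)
    {A : Set (ι → ℝ)} (hA : MeasurableSet A) :
    (Measure.pi fun _ : ι => gaussianReal 0 (Real.toNNReal (σ ^ 2))) {z | (fun i => a i + z i) ∈ A} ≤
      ENNReal.ofReal (exp ε) *
        (Measure.pi fun _ : ι => gaussianReal 0 (Real.toNNReal (σ ^ 2)))
          {z | (fun i => b i + z i) ∈ A} + ENNReal.ofReal δ := by
  obtain ⟨hε0, hε1⟩ := hε
  set c := √(2 * log (1.25 / δ)) with hc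
  have hcpos : 0 < c := sqrt_pos.2 (mul_pos two_pos (log_five_fourths_div_pos hδ))
  have hσ0 : 0 < σ := by rw [hσ]; positivity
  set v : ℝ≥0 := Real.toNNReal (σ ^ 2) with hvdef
  have hvσ : (v : ℝ) = σ ^ 2 := Real.coe_toNNReal _ (sq_nonneg σ)
  have hv : v ≠ 0 := by
    intro h
    rw [h, NNReal.coe_zero] at hvσ
    exact (pow_pos hσ0 2).ne hvσ
  set μ := Measure.pi fun _ : ι => gaussianReal 0 v with hμ
  set e : ι → ℝ := fun i => a i - b i with he
  rcases eq_or_ne e 0 with h0 | h0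
  · have hab' : a = b := by
      ext i
      have := congrFun h0 i
      simpa [he, sub_eq_zero] using this
    rw [hab']
    refine le_add_right (le_mul_of_one_le_left' ?_)
    rw [← ENNReal.ofReal_one]
    exact ENNReal.ofReal_le_ofReal (one_le_exp hε0.le)
  set s := √(∑ i, e i ^ 2) with hs
  have hsum : 0 < ∑ i, e i ^ 2 := by
    obtain ⟨i, hi⟩ := Function.ne_iff.1 h0
    exact Finset.sum_pos' (fun _ _ => sq_nonneg _) ⟨i, Finset.mem_univ i, by
      have : e i ≠ 0 := hi
      positivity⟩
  have hs0 : 0 < s := sqrt_pos.2 hsum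
  have hs2 : s ^ 2 = ∑ i, e i ^ 2 := sq_sqrt hsum.le
  have hsΔ : s ≤ Δ := by
    rw [hs]
    exact sqrt_le_iff.2 ⟨hΔ.le, hab⟩
  set B : Set (ι → ℝ) := {z | (fun i => b i + z i) ∈ A} with hB
  have hBm : MeasurableSet B := by
    have : Measurable fun z : ι → ℝ => (fun i => b i + z i) := by fun_prop
    exact this hA
  have hshift : μ.map (fun z i => z i + e i) = Measure.pi (fun i => gaussianReal (e i) v) := by
    rw [hμ]
    rw [Measure.pi_map_pi (f := fun i x => x + e i) (by fun_prop)]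
    congr 1
    ext1 i
    rw [gaussianReal_map_add_const, zero_add]
  have hshm : Measurable fun (z : ι → ℝ) i => z i + e i := by fun_prop
  have hAB : μ {z | (fun i => a i + z i) ∈ A} = μ.map (fun z i => z i + e i) B := by
    rw [Measure.map_apply hshm hBm]
    congr 1
    ext z
    simp only [Set.mem_ofPred_eq, hB, Set.mem_preimage, he]
    have : (fun i => a i + z i) = fun i => b i + (z i + (a i - b i)) := by ext i; ring
    rw [this]
  set G : Set (ι → ℝ) := {z | (∑ i, z i * e i - (∑ i, e i ^ 2) / 2) / v ≤ ε} with hG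
  have hGm : MeasurableSet G := measurableSet_le (by fun_prop) measurable_const
  have h1 : μ.map (fun z i => z i + e i) (B ∩ G) ≤ ENNReal.ofReal (exp ε) * μ B := by
    rw [hshift, pi_gaussianReal_eq_withDensity hv, withDensity_apply _ (hBm.inter hGm)]
    calc _ ≤ ∫⁻ z in B ∩ G, ENNReal.ofReal (exp ε) ∂μ :=
          setLIntegral_mono (by fun_prop) fun z hz =>
            ENNReal.ofReal_le_ofReal (exp_le_exp.2 hz.2)
      _ ≤ _ := by
          rw [setLIntegral_const]
          gcongr
          exact Set.inter_subset_left
  have h2 : μ.map (fun z i => z i + e i) Gᶜ ≤ ENNReal.ofReal δ := by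
    rw [Measure.map_apply hshm hGm.compl]
    set x := σ * ε / s - s / (2 * σ) with hx
    have hset : (fun (z : ι → ℝ) i => z i + e i) ⁻¹' Gᶜ =
        (fun z : ι → ℝ => ∑ i, z i * (e i / (s * σ))) ⁻¹' Set.Ioi x := by
      ext z
      simp only [hG, Set.mem_preimage, Set.mem_compl_iff, Set.mem_ofPred_eq, not_le, Set.mem_Ioi,
        add_mul, Finset.sum_add_distrib, ← sq, hvσ, ← hs2, ← mul_div_assoc, ← Finset.sum_div, hx]
      rw [lt_div_iff₀ (by positivity), lt_div_iff₀ (by positivity)]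
      have : (σ * ε / s - s / (2 * σ)) * (s * σ) = ε * σ ^ 2 - s ^ 2 / 2 := by
        field_simp
      rw [this]
      constructor <;> intro h <;> linarith
    have hlaw := map_sum_mul_pi_gaussianReal v (fun i => e i / (s * σ)) (v⁻¹) (by
      simp only [div_pow]
      rw [← Finset.sum_div, ← hs2, NNReal.coe_inv, hvσ]
      field_simp)
    rw [inv_mul_cancel₀ hv] at hlaw
    rw [hset, ← Measure.map_apply (by fun_prop) measurableSet_Ioi, hlaw]
    refine gaussianReal_Ioi_le_delta hδ hc ?_
    have e1 : σ * ε = Δ * c := by rw [hσ]; field_simp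
    have e2 : c ≤ σ * ε / s := by
      rw [le_div_iff₀ hs0, e1]
      nlinarith
    have e3 : s / (2 * σ) ≤ 1 / (2 * c) := by
      rw [div_le_div_iff₀ (by positivity) (by positivity)]
      nlinarith
    rw [hx]
    linarith
  rw [hAB]
  calc _ ≤ μ.map (fun z i => z i + e i) (B ∩ G ∪ Gᶜ) := by
        refine measure_mono fun z hz => ?_
        by_cases h : z ∈ G
        · exact Or.inl ⟨hz, h⟩
        · exact Or.inr h
    _ ≤ _ := (measure_union_le _ _).trans (add_le_add h1 h2)

lemma hasDerivAt_logisticLoss (z : ℝ) :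
    HasDerivAt logisticLoss (-(1 + exp z)⁻¹) z := by
  have h : HasDerivAt (fun z : ℝ => 1 + exp (-z)) (exp (-z) * -1) z :=
    ((hasDerivAt_neg z).exp).const_add 1
  have h2 := h.log (by positivity)
  refine h2.congr_deriv ?_
  rw [exp_neg]
  field_simp
  ring

lemma abs_logisticLoss_sub_le (x y : ℝ) : |logisticLoss y - logisticLoss x| ≤ |y - x| := by
  have := convex_univ.norm_image_sub_le_of_norm_hasDerivWithin_le (𝕜 := ℝ) (C := 1)
    (fun z _ => (hasDerivAt_logisticLoss z).hasDerivWithinAt) (fun z _ => ?_)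
    (Set.mem_univ x) (Set.mem_univ y)
  · simpa using this
  · rw [norm_neg, norm_inv, norm_eq_abs, abs_of_pos (by positivity)]
    exact inv_le_one_of_one_le₀ (by linarith [exp_pos z])

lemma abs_inv_one_add_exp_sub_le (x y : ℝ) :
    |(1 + exp y)⁻¹ - (1 + exp x)⁻¹| ≤ |y - x| := by
  have hd (z : ℝ) : HasDerivAt (fun z : ℝ => (1 + exp z)⁻¹) (-exp z / (1 + exp z) ^ 2) z :=
    ((hasDerivAt_exp z).const_add 1).fun_inv (by positivity)
  have := convex_univ.norm_image_sub_le_of_norm_hasDerivWithin_le (𝕜 := ℝ) (C := 1)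
    (fun z _ => (hd z).hasDerivWithinAt) (fun z _ => ?_)
    (Set.mem_univ x) (Set.mem_univ y)
  · simpa using this
  · rw [norm_div, norm_neg, norm_eq_abs, norm_eq_abs, abs_of_pos (by positivity),
      abs_of_pos (by positivity), div_le_one (by positivity)]
    nlinarith [exp_pos z]

lemma abs_logisticLoss_taylor_le (x y : ℝ) :
    |logisticLoss y - logisticLoss x + (1 + exp x)⁻¹ * (y - x)| ≤ (y - x) ^ 2 := by
  have hd (z : ℝ) : HasDerivAt (fun z => logisticLoss z + (1 + exp x)⁻¹ * z)
      (-(1 + exp z)⁻¹ + (1 + exp x)⁻¹) z := by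
    have := (hasDerivAt_logisticLoss z).fun_add ((hasDerivAt_id' z).const_mul (1 + exp x)⁻¹)
    simpa using this
  have := (convex_uIcc x y).norm_image_sub_le_of_norm_hasDerivWithin_le (𝕜 := ℝ) (C := |y - x|)
    (fun z _ => (hd z).hasDerivWithinAt) (fun z hz => ?_)
    Set.left_mem_uIcc Set.right_mem_uIcc
  · rw [norm_eq_abs, norm_eq_abs, ← sq, sq_abs] at this
    convert this using 2
    ring
  · rw [norm_eq_abs, ← abs_neg, neg_add, neg_neg, ← sub_eq_add_neg]
    refine (abs_inv_one_add_exp_sub_le x z).trans ?_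
    rw [abs_sub_comm z, abs_sub_comm y, abs_sub_comm x z, abs_sub_comm x y]
    exact Set.abs_sub_left_of_mem_uIcc hz

/-- The value at `x` of the Bernstein basis polynomial of index `j` and degree `K`. -/
def bernsteinBasis (K j : ℕ) (x : ℝ) : ℝ := K.choose j * x ^ j * (1 - x) ^ (K - j)

lemma bernsteinBasis_nonneg {K j : ℕ} {x : ℝ} (hx : x ∈ Set.Icc (0 : ℝ) 1) :
    0 ≤ bernsteinBasis K j x := by
  have h1 := hx.1
  have h2 : 0 ≤ 1 - x := by linarith [hx.2]
  unfold bernsteinBasis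
  positivity

lemma sum_bernsteinBasis (K : ℕ) (x : ℝ) :
    ∑ j ∈ range (K + 1), bernsteinBasis K j x = 1 := by
  simpa [bernsteinPolynomial, Polynomial.eval_finsetSum, bernsteinBasis] using
    congrArg (Polynomial.eval x) (bernsteinPolynomial.sum ℝ K)

lemma sum_mul_bernsteinBasis {K : ℕ} (hK : K ≠ 0) (x : ℝ) :
    ∑ j ∈ range (K + 1), (j / K : ℝ) * bernsteinBasis K j x = x := by
  have h := congrArg (Polynomial.eval x) (bernsteinPolynomial.sum_smul ℝ K)
  simp [bernsteinPolynomial, Polynomial.eval_finsetSum] at h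
  have hK' : (K : ℝ) ≠ 0 := by exact_mod_cast hK
  simp_rw [div_mul_eq_mul_div, ← Finset.sum_div, bernsteinBasis]
  rw [h]
  field_simp

lemma sum_sq_mul_bernsteinBasis {K : ℕ} (hK : K ≠ 0) (x : ℝ) :
    ∑ j ∈ range (K + 1), (j / K - x : ℝ) ^ 2 * bernsteinBasis K j x = x * (1 - x) / K := by
  have h := congrArg (Polynomial.eval x) (bernsteinPolynomial.variance ℝ K)
  simp [bernsteinPolynomial, Polynomial.eval_finsetSum] at h
  have hK' : (K : ℝ) ≠ 0 := by exact_mod_cast hK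
  have h2 : ∀ j ∈ range (K + 1), (j / K - x : ℝ) ^ 2 * bernsteinBasis K j x =
      (K * x - j) ^ 2 * (K.choose j * x ^ j * (1 - x) ^ (K - j)) / K ^ 2 := by
    intro j _
    rw [bernsteinBasis]
    field_simp
    ring
  rw [Finset.sum_congr rfl h2, ← Finset.sum_div, h]
  field_simp

/-- The degree `K` Bernstein approximation of the logistic loss on `[-R, R]`. -/
lemma abs_logisticLoss_sub_bernstein_le {K : ℕ} (hK : K ≠ 0) {R z : ℝ} (hR : 0 < R)
    (hz : |z| ≤ R) :
    |logisticLoss z - ∑ j ∈ range (K + 1), logisticLoss (R * (2 * (j / K) - 1)) *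
      bernsteinBasis K j ((1 + z / R) / 2)| ≤ R ^ 2 / K := by
  set x := (1 + z / R) / 2 with hx
  have hKpos : (0 : ℝ) < K := by exact_mod_cast Nat.pos_of_ne_zero hK
  have hzR : |z / R| ≤ 1 := by rw [abs_div, abs_of_pos hR, div_le_one hR]; exact hz
  obtain ⟨h1, h2⟩ := abs_le.1 hzR
  have hx01 : x ∈ Set.Icc (0 : ℝ) 1 := ⟨by rw [hx]; linarith, by rw [hx]; linarith⟩
  have hzx : z = R * (2 * x - 1) := by rw [hx]; field_simp; ring
  have e1 : logisticLoss z - ∑ j ∈ range (K + 1), logisticLoss (R * (2 * (j / K) - 1)) *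
      bernsteinBasis K j x = -∑ j ∈ range (K + 1), (logisticLoss (R * (2 * (j / K) - 1)) -
        logisticLoss z + (1 + exp z)⁻¹ * (R * (2 * (j / K) - 1) - z)) * bernsteinBasis K j x := by
    have : ∀ j ∈ range (K + 1), (logisticLoss (R * (2 * (j / K) - 1)) -
        logisticLoss z + (1 + exp z)⁻¹ * (R * (2 * (j / K) - 1) - z)) * bernsteinBasis K j x =
        logisticLoss (R * (2 * (j / K) - 1)) * bernsteinBasis K j x -
        (logisticLoss z + (1 + exp z)⁻¹ * (2 * R * x)) * bernsteinBasis K j x +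
        ((1 + exp z)⁻¹ * (2 * R)) * ((j / K : ℝ) * bernsteinBasis K j x) := by
      intro j _
      rw [show R * (2 * (j / K : ℝ) - 1) - z = 2 * R * (j / K) - 2 * R * x by rw [hzx]; ring]
      ring
    rw [Finset.sum_congr rfl this, Finset.sum_add_distrib, Finset.sum_sub_distrib,
      ← Finset.mul_sum, ← Finset.mul_sum, sum_bernsteinBasis, sum_mul_bernsteinBasis hK]
    ring
  rw [e1, abs_neg]
  calc _ ≤ ∑ j ∈ range (K + 1), (2 * R) ^ 2 * ((j / K - x : ℝ) ^ 2 * bernsteinBasis K j x) := by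
        refine (Finset.abs_sum_le_sum_abs _ _).trans (Finset.sum_le_sum fun j _ => ?_)
        rw [abs_mul, abs_of_nonneg (bernsteinBasis_nonneg hx01), ← mul_assoc]
        refine mul_le_mul_of_nonneg_right ?_ (bernsteinBasis_nonneg hx01)
        refine (abs_logisticLoss_taylor_le _ _).trans (le_of_eq ?_)
        rw [hzx]
        ring
    _ = (2 * R) ^ 2 * (x * (1 - x) / K) := by
        rw [← Finset.mul_sum, sum_sq_mul_bernsteinBasis hK]
    _ ≤ _ := by
        rw [← mul_div_assoc]
        gcongr
        nlinarith [sq_nonneg (2 * x - 1), sq_nonneg (R * (2 * x - 1))]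

section Marginals

variable {m n : ℕ} {Ω : Fin (m+1) → Finset ℝ}

lemma sum_marginal_mul {D : Fin n → Fin (m+1) → ℝ} (hD : ValidDataset Ω D)
    (q : Finset (Fin (m+1))) (G : (∀ j ∈ q, ℝ) → ℝ) :
    ∑ i, G (fun j _ => D i j) = ∑ t ∈ q.pi Ω, marginal D q t * G t := by
  classical
  rw [← Finset.sum_fiberwise_of_maps_to (s := univ) (t := q.pi Ω)
    (g := fun i => (fun j (_ : j ∈ q) => D i j))
    (fun i _ => Finset.mem_pi.2 fun j _ => hD i j)]
  refine Finset.sum_congr rfl fun t _ => ?_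
  have h : ∀ i ∈ univ.filter (fun i => (fun j (_ : j ∈ q) => D i j) = t),
      G (fun j _ => D i j) = G t := fun i hi => by rw [(Finset.mem_filter.1 hi).2]
  rw [Finset.sum_congr rfl h, Finset.sum_const, nsmul_eq_mul, marginal]
  congr 2
  rw [Nat.card_eq_fintype_card, Fintype.card_subtype]
  congr 1
  ext i
  simp [funext_iff]

lemma abs_sum_sub_sum_le_margL1 {D D' : Fin n → Fin (m+1) → ℝ} (hD : ValidDataset Ω D)
    (hD' : ValidDataset Ω D') (q : Finset (Fin (m+1))) (G : (∀ j ∈ q, ℝ) → ℝ)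
    (hG : ∀ t ∈ q.pi Ω, |G t| ≤ 1) :
    |∑ i, G (fun j _ => D i j) - ∑ i, G (fun j _ => D' i j)| ≤ margL1 Ω D D' q := by
  rw [sum_marginal_mul hD, sum_marginal_mul hD', ← Finset.sum_sub_distrib, margL1]
  refine (Finset.abs_sum_le_sum_abs _ _).trans (Finset.sum_le_sum fun t ht => ?_)
  rw [← sub_mul, abs_mul]
  exact mul_le_of_le_one_right (abs_nonneg _) (hG t ht)

variable {d : ℕ} {E : ℝ}

lemma abs_sum_monomial_sub_le {D D' : Fin n → Fin (m+1) → ℝ} (hΩ : ValidDomains m Ω)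
    (hD : ValidDataset Ω D) (hD' : ValidDataset Ω D')
    (hE : ∀ q : Finset (Fin (m+1)), q.Nonempty → q.card ≤ d → margL1 Ω D D' q ≤ E)
    {k : ℕ} (hk : k + 1 ≤ d) (p : Fin k → Fin m) :
    |∑ i, ∏ s, (D i (p s).castSucc * D i (Fin.last m)) -
      ∑ i, ∏ s, (D' i (p s).castSucc * D' i (Fin.last m))| ≤ E := by
  classical
  set q : Finset (Fin (m+1)) := insert (Fin.last m) (univ.image fun s => (p s).castSucc) with hq
  have hlast : Fin.last m ∈ q := Finset.mem_insert_self _ _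
  have hmem (s : Fin k) : (p s).castSucc ∈ q :=
    Finset.mem_insert_of_mem (Finset.mem_image_of_mem _ (Finset.mem_univ s))
  have hcard : q.card ≤ d := by
    refine ((Finset.card_insert_le _ _).trans ?_).trans hk
    have := Finset.card_image_le (s := univ) (f := fun s => (p s).castSucc)
    simpa using this
  refine le_trans ?_ (hE q ⟨_, hlast⟩ hcard)
  refine abs_sum_sub_sum_le_margL1 hD hD' q
    (fun t => ∏ s, (t (p s).castSucc (hmem s) * t (Fin.last m) hlast)) fun t ht => ?_
  have hle (j) (hj : j ∈ q) : |t j hj| ≤ 1 := abs_le.2 (hΩ.1 j (Finset.mem_pi.1 ht j hj))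
  rw [Finset.abs_prod]
  refine Finset.prod_le_one (fun _ _ => abs_nonneg _) fun s _ => ?_
  rw [abs_mul]
  exact mul_le_one₀ (hle _ _) (abs_nonneg _) (hle _ _)

lemma abs_sum_margin_pow_sub_le {D D' : Fin n → Fin (m+1) → ℝ} (hΩ : ValidDomains m Ω)
    (hD : ValidDataset Ω D) (hD' : ValidDataset Ω D')
    (hE : ∀ q : Finset (Fin (m+1)), q.Nonempty → q.card ≤ d → margL1 Ω D D' q ≤ E)
    (w : EuclideanSpace ℝ (Fin m)) {k : ℕ} (hk : k + 1 ≤ d) :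
    |∑ i, margin w (D i) ^ k - ∑ i, margin w (D' i) ^ k| ≤ (∑ j, |w j|) ^ k * E := by
  have hexp (D : Fin n → Fin (m+1) → ℝ) : ∑ i, margin w (D i) ^ k =
      ∑ p : Fin k → Fin m, (∏ s, w (p s)) *
        ∑ i, ∏ s, (D i (p s).castSucc * D i (Fin.last m)) := by
    simp_rw [margin, Finset.sum_mul, Fintype.sum_pow, Finset.mul_sum, mul_assoc,
      Finset.prod_mul_distrib]
    exact Finset.sum_comm
  rw [hexp, hexp, ← Finset.sum_sub_distrib, Fintype.sum_pow, Finset.sum_mul]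
  refine (Finset.abs_sum_le_sum_abs _ _).trans (Finset.sum_le_sum fun p _ => ?_)
  rw [← mul_sub, abs_mul, Finset.abs_prod]
  exact mul_le_mul_of_nonneg_left (abs_sum_monomial_sub_le hΩ hD hD' hE hk p)
    (Finset.prod_nonneg fun _ _ => abs_nonneg _)

lemma sum_abs_le_sqrt_mul_norm (w : EuclideanSpace ℝ (Fin m)) :
    ∑ j, |w j| ≤ √m * ‖w‖ := by
  rw [EuclideanSpace.norm_eq, ← sqrt_mul (Nat.cast_nonneg _)]
  refine le_sqrt_of_sq_le ?_
  have := sq_sum_le_card_mul_sum_sq (s := (univ : Finset (Fin m))) (f := fun j => |w j|)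
  simpa using this

lemma abs_margin_le {D : Fin n → Fin (m+1) → ℝ} (hΩ : ValidDomains m Ω)
    (hD : ValidDataset Ω D) (w : EuclideanSpace ℝ (Fin m)) (i : Fin n) :
    |margin w (D i)| ≤ √m * ‖w‖ := by
  have hle (j) : |D i j| ≤ 1 := abs_le.2 (hΩ.1 j (hD i j))
  rw [margin, abs_mul]
  refine (mul_le_of_le_one_right (abs_nonneg _) (hle _)).trans ?_
  refine ((Finset.abs_sum_le_sum_abs _ _).trans (Finset.sum_le_sum fun j _ => ?_)).trans
    (sum_abs_le_sqrt_mul_norm w)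
  rw [abs_mul]
  exact mul_le_of_le_one_right (abs_nonneg _) (hle _)

lemma abs_sum_bernsteinBasis_sub_le {D D' : Fin n → Fin (m+1) → ℝ} (hΩ : ValidDomains m Ω)
    (hD : ValidDataset Ω D) (hD' : ValidDataset Ω D')
    (hE : ∀ q : Finset (Fin (m+1)), q.Nonempty → q.card ≤ d → margL1 Ω D D' q ≤ E)
    {w : EuclideanSpace ℝ (Fin m)} {R : ℝ} (hR : 0 < R) (hw : √m * ‖w‖ ≤ R)
    {K j : ℕ} (hK : K + 1 ≤ d) (hj : j ≤ K) :
    |∑ i, bernsteinBasis K j ((1 + margin w (D i) / R) / 2) -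
      ∑ i, bernsteinBasis K j ((1 + margin w (D' i) / R) / 2)| ≤ K.choose j * E := by
  have hE0 : 0 ≤ E :=
    le_trans (Finset.sum_nonneg fun _ _ => abs_nonneg _)
      (hE {0} (Finset.singleton_nonempty 0) (by simp; omega))
  have hexp (u : ℝ) : bernsteinBasis K j ((1 + u / R) / 2) =
      ∑ a ∈ range (j + 1), ∑ b ∈ range (K - j + 1),
        (K.choose j / 2 ^ K * j.choose a * ((-1) ^ b * (K - j).choose b) / R ^ (a + b)) *
          u ^ (a + b) := by
    have h1 : (1 + u / R) ^ j = ∑ a ∈ range (j + 1), (j.choose a : ℝ) * (u / R) ^ a := by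
      rw [add_comm, add_pow]
      exact Finset.sum_congr rfl fun a _ => by ring
    have h2 : (1 - u / R) ^ (K - j) =
        ∑ b ∈ range (K - j + 1), ((-1) ^ b * (K - j).choose b : ℝ) * (u / R) ^ b := by
      rw [sub_eq_add_neg, add_comm, add_pow]
      exact Finset.sum_congr rfl fun a _ => by rw [neg_pow]; ring
    have h3 : bernsteinBasis K j ((1 + u / R) / 2) =
        K.choose j / 2 ^ K * ((1 + u / R) ^ j * (1 - u / R) ^ (K - j)) := by
      have e : 1 - (1 + u / R) / 2 = (1 - u / R) / 2 := by ring
      have e2 : (2 : ℝ) ^ K = 2 ^ j * 2 ^ (K - j) := by rw [← pow_add, Nat.add_sub_cancel' hj]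
      rw [bernsteinBasis, e, div_pow, div_pow, e2]
      field_simp
    rw [h3, h1, h2, Finset.sum_mul_sum, Finset.mul_sum]
    refine Finset.sum_congr rfl fun a _ => ?_
    rw [Finset.mul_sum]
    refine Finset.sum_congr rfl fun b _ => ?_
    rw [div_pow, div_pow, pow_add, pow_add]
    field_simp
  have hsum (D : Fin n → Fin (m+1) → ℝ) :
      ∑ i, bernsteinBasis K j ((1 + margin w (D i) / R) / 2) =
      ∑ a ∈ range (j + 1), ∑ b ∈ range (K - j + 1),
        (K.choose j / 2 ^ K * j.choose a * ((-1) ^ b * (K - j).choose b) / R ^ (a + b)) *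
          ∑ i, margin w (D i) ^ (a + b) := by
    simp_rw [hexp, Finset.mul_sum]
    rw [Finset.sum_comm]
    refine Finset.sum_congr rfl fun a _ => ?_
    rw [Finset.sum_comm]
  have hw1 := (sum_abs_le_sqrt_mul_norm w).trans hw
  rw [hsum, hsum, ← Finset.sum_sub_distrib]
  simp_rw [← Finset.sum_sub_distrib, ← mul_sub]
  calc _ ≤ ∑ a ∈ range (j + 1), ∑ b ∈ range (K - j + 1),
        (K.choose j / 2 ^ K * E : ℝ) * ((j.choose a : ℝ) * ((K - j).choose b : ℝ)) := by
        refine (Finset.abs_sum_le_sum_abs _ _).trans (Finset.sum_le_sum fun a ha => ?_)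
        refine (Finset.abs_sum_le_sum_abs _ _).trans (Finset.sum_le_sum fun b hb => ?_)
        rw [Finset.mem_range] at ha hb
        have h := abs_sum_margin_pow_sub_le hΩ hD hD' hE w (k := a + b) (by omega)
        have h' : (∑ j, |w j|) ^ (a + b) * E ≤ R ^ (a + b) * E := by gcongr
        have hc : |(K.choose j / 2 ^ K * j.choose a * ((-1) ^ b * (K - j).choose b) /
            R ^ (a + b) : ℝ)| =
            K.choose j / 2 ^ K * j.choose a * (K - j).choose b / R ^ (a + b) := by
          rw [abs_div, abs_mul, abs_mul, abs_mul, abs_div, abs_pow (-1 : ℝ), abs_neg, abs_one,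
            one_pow, one_mul, Nat.abs_cast, Nat.abs_cast, Nat.abs_cast,
            abs_of_pos (pow_pos hR _), abs_of_pos (pow_pos (two_pos (α := ℝ)) _)]
        rw [abs_mul, hc]
        calc _ ≤ K.choose j / 2 ^ K * j.choose a * (K - j).choose b / R ^ (a + b) *
              (R ^ (a + b) * E) := by
              gcongr
              exact h.trans h'
          _ = _ := by field_simp
    _ = (K.choose j / 2 ^ K * E : ℝ) * ((∑ a ∈ range (j + 1), (j.choose a : ℝ)) *
          ∑ b ∈ range (K - j + 1), ((K - j).choose b : ℝ)) := by
        rw [Finset.sum_mul_sum, Finset.mul_sum]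
        exact Finset.sum_congr rfl fun a _ => by rw [Finset.mul_sum]
    _ = K.choose j * E := by
        rw [← Nat.cast_sum, ← Nat.cast_sum, Nat.sum_range_choose, Nat.sum_range_choose,
          ← Nat.cast_mul, ← pow_add, Nat.add_sub_cancel' hj]
        push_cast
        field_simp

lemma abs_risk_sub_risk_le {D D' : Fin n → Fin (m+1) → ℝ} (hn : 1 ≤ n) (hΩ : ValidDomains m Ω)
    (hD : ValidDataset Ω D) (hD' : ValidDataset Ω D')
    (hE : ∀ q : Finset (Fin (m+1)), q.Nonempty → q.card ≤ d → margL1 Ω D D' q ≤ E)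
    {w : EuclideanSpace ℝ (Fin m)} {R : ℝ} (hR : 0 < R) (hw : √m * ‖w‖ ≤ R)
    {K : ℕ} (hK0 : K ≠ 0) (hK : K + 1 ≤ d) :
    |risk logisticLoss w D - risk logisticLoss w D'| ≤
      2 * (R ^ 2 / K) + 1 / n * (R * 2 ^ K * E) := by
  have hn' : (0 : ℝ) < n := by exact_mod_cast hn
  have hKpos : (0 : ℝ) < K := by exact_mod_cast Nat.pos_of_ne_zero hK0
  have hE0 : 0 ≤ E :=
    le_trans (Finset.sum_nonneg fun _ _ => abs_nonneg _)
      (hE {0} (Finset.singleton_nonempty 0) (by simp; omega))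
  set P : ℝ → ℝ := fun z => ∑ j ∈ range (K + 1), logisticLoss (R * (2 * (j / K) - 1)) *
      bernsteinBasis K j ((1 + z / R) / 2) with hP
  have happ (D : Fin n → Fin (m+1) → ℝ) (hD : ValidDataset Ω D) :
      |∑ i, logisticLoss (margin w (D i)) - ∑ i, P (margin w (D i))| ≤ n * (R ^ 2 / K) := by
    rw [← Finset.sum_sub_distrib]
    refine (Finset.abs_sum_le_sum_abs _ _).trans ?_
    refine (Finset.sum_le_card_nsmul _ _ (R ^ 2 / K) fun i _ =>
      abs_logisticLoss_sub_bernstein_le hK0 hR ((abs_margin_le hΩ hD w i).trans hw)).trans ?_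
    simp
  have hPsum (D : Fin n → Fin (m+1) → ℝ) : ∑ i, P (margin w (D i)) =
      n * logisticLoss 0 + ∑ j ∈ range (K + 1),
        (logisticLoss (R * (2 * (j / K) - 1)) - logisticLoss 0) *
          ∑ i, bernsteinBasis K j ((1 + margin w (D i) / R) / 2) := by
    have h1 (z : ℝ) : P z = logisticLoss 0 + ∑ j ∈ range (K + 1),
        (logisticLoss (R * (2 * (j / K) - 1)) - logisticLoss 0) *
          bernsteinBasis K j ((1 + z / R) / 2) := by
      simp_rw [sub_mul, Finset.sum_sub_distrib, ← Finset.mul_sum, sum_bernsteinBasis, hP]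
      ring
    simp_rw [h1, Finset.sum_add_distrib, Finset.mul_sum]
    rw [Finset.sum_comm]
    simp
  have hPdiff : |∑ i, P (margin w (D i)) - ∑ i, P (margin w (D' i))| ≤ R * 2 ^ K * E := by
    rw [hPsum, hPsum, add_sub_add_left_eq_sub, ← Finset.sum_sub_distrib]
    calc _ ≤ ∑ j ∈ range (K + 1), R * ((K.choose j : ℝ) * E) := by
          refine (Finset.abs_sum_le_sum_abs _ _).trans (Finset.sum_le_sum fun j hj => ?_)
          rw [← mul_sub, abs_mul]
          have hjK : j ≤ K := Nat.lt_succ_iff.1 (Finset.mem_range.1 hj)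
          refine mul_le_mul ?_ (abs_sum_bernsteinBasis_sub_le hΩ hD hD' hE hR hw hK hjK)
            (abs_nonneg _) hR.le
          refine (abs_logisticLoss_sub_le _ _).trans ?_
          have h1 : (j : ℝ) / K ≤ 1 := div_le_one_of_le₀ (by exact_mod_cast hjK) hKpos.le
          have h0 : (0 : ℝ) ≤ (j : ℝ) / K := by positivity
          rw [sub_zero, abs_mul, abs_of_pos hR]
          exact mul_le_of_le_one_right hR.le (abs_le.2 ⟨by linarith, by linarith⟩)
      _ = _ := by
          rw [← Finset.mul_sum, ← Finset.sum_mul, ← Nat.cast_sum, Nat.sum_range_choose]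
          push_cast
          ring
  rw [risk, risk, ← mul_sub, abs_mul, abs_of_pos (by positivity)]
  have h1 := abs_le.1 (happ D hD)
  have h2 := abs_le.1 (happ D' hD')
  have h3 := abs_le.1 hPdiff
  calc _ ≤ 1 / n * (2 * (n * (R ^ 2 / K)) + R * 2 ^ K * E : ℝ) := by
        gcongr
        exact abs_le.2 ⟨by linarith, by linarith⟩
    _ = _ := by field_simp

end Marginals

section Mechanism

variable {m n d : ℕ} {Ω : Fin (m+1) → Finset ℝ}

lemma sum_margIdx {M : Type*} [AddCommMonoid M] (f : MargIdx m d Ω → M) :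
    ∑ p, f p = ∑ q : {q : Finset (Fin (m+1)) // q.Nonempty ∧ q.card ≤ d},
      ∑ t ∈ ((q : Finset (Fin (m+1))).pi Ω).attach, f ⟨q, t⟩ := by
  exact Fintype.sum_sigma f

lemma sum_sq_marginal_sub_le {D D' : Fin n → Fin (m+1) → ℝ} (h : Adjacent D D')
    (q : Finset (Fin (m+1))) :
    ∑ t ∈ q.pi Ω, (marginal D q t - marginal D' q t) ^ 2 ≤ 2 := by
  classical
  obtain ⟨i₀, hi, -⟩ := h
  have hmarg (D : Fin n → Fin (m+1) → ℝ) (t : ∀ j ∈ q, ℝ) : marginal D q t =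
      ∑ i, if (fun j (_ : j ∈ q) => D i j) = t then (1 : ℝ) else 0 := by
    rw [marginal, Nat.card_eq_fintype_card, Fintype.card_subtype, Finset.sum_boole]
    congr 2
    ext i
    simp [funext_iff]
  have hle (t : ∀ j ∈ q, ℝ) : (marginal D q t - marginal D' q t) ^ 2 ≤
      (if (fun j (_ : j ∈ q) => D i₀ j) = t then (1 : ℝ) else 0) +
        if (fun j (_ : j ∈ q) => D' i₀ j) = t then (1 : ℝ) else 0 := by
    rw [hmarg, hmarg, ← Finset.sum_sub_distrib,
      Finset.sum_eq_single i₀ (fun i _ hne => by rw [hi i hne, sub_self]) (by simp)]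
    split_ifs <;> norm_num
  have hone (v : ∀ j ∈ q, ℝ) : ∑ t ∈ q.pi Ω, (if v = t then (1 : ℝ) else 0) ≤ 1 := by
    rw [Finset.sum_ite_eq]
    split_ifs <;> norm_num
  calc _ ≤ _ := Finset.sum_le_sum fun t _ => hle t
    _ ≤ 1 + 1 := by
        rw [Finset.sum_add_distrib]
        exact add_le_add (hone _) (hone _)
    _ = 2 := by norm_num

lemma sum_sq_margVec_sub_le {D D' : Fin n → Fin (m+1) → ℝ} (h : Adjacent D D') :
    ∑ p : MargIdx m d Ω, (margVec Ω D p - margVec Ω D' p) ^ 2 ≤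
      2 * Fintype.card {q : Finset (Fin (m+1)) // q.Nonempty ∧ q.card ≤ d} := by
  rw [sum_margIdx]
  refine (Finset.sum_le_card_nsmul _ _ 2 fun q _ => ?_).trans ?_
  · refine le_trans (le_of_eq ?_) (sum_sq_marginal_sub_le (Ω := Ω) h q)
    exact Finset.sum_attach _ fun t => (marginal D q t - marginal D' q t) ^ 2
  · rw [nsmul_eq_mul, mul_comm]
    rfl

lemma card_pi_le {l : ℕ} (hl : l = univ.sup fun j : Fin (m+1) => (Ω j).card) (hl1 : 1 ≤ l)
    {q : Finset (Fin (m+1))} (hq : q.card ≤ d) : (q.pi Ω).card ≤ l ^ d := by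
  rw [Finset.card_pi]
  refine (Finset.prod_le_pow_card _ _ l fun j _ => ?_).trans (Nat.pow_le_pow_right hl1 hq)
  rw [hl]
  exact Finset.le_sup (f := fun j : Fin (m+1) => (Ω j).card) (Finset.mem_univ j)

lemma card_margIdx_le {l : ℕ} (hl : l = univ.sup fun j : Fin (m+1) => (Ω j).card)
    (hl1 : 1 ≤ l)
    (hQ : Fintype.card {q : Finset (Fin (m+1)) // q.Nonempty ∧ q.card ≤ d} ≤ m ^ d) :
    Fintype.card (MargIdx m d Ω) ≤ (m * l) ^ d := by
  have h := sum_margIdx (fun _ : MargIdx m d Ω => 1)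
  simp only [Finset.sum_const, smul_eq_mul, mul_one, Finset.card_univ, Finset.card_attach] at h
  rw [h, mul_pow]
  refine (Finset.sum_le_card_nsmul _ _ (l ^ d) fun q _ => card_pi_le hl hl1 q.2.2).trans ?_
  rw [smul_eq_mul]
  exact Nat.mul_le_mul_right _ hQ

lemma le_maxDistToMarginals (h : MargIdx m d Ω → ℝ) (D : Fin n → Fin (m+1) → ℝ)
    (q : {q : Finset (Fin (m+1)) // q.Nonempty ∧ q.card ≤ d}) :
    ∑ t ∈ ((q : Finset (Fin (m+1))).pi Ω).attach,
      |h ⟨q, t⟩ - marginal D (q : Finset (Fin (m+1))) t.1| ≤ maxDistToMarginals Ω h D := by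
  refine le_csSup (Set.Finite.bddAbove ?_) ⟨q, rfl⟩
  refine (Set.finite_range fun q : {q : Finset (Fin (m+1)) // q.Nonempty ∧ q.card ≤ d} =>
    ∑ t ∈ ((q : Finset (Fin (m+1))).pi Ω).attach,
      |h ⟨q, t⟩ - marginal D (q : Finset (Fin (m+1))) t.1|).subset ?_
  rintro r ⟨q, rfl⟩
  exact ⟨q, rfl⟩

lemma margL1_sel_le {l : ℕ} (hl : l = univ.sup fun j : Fin (m+1) => (Ω j).card) (hl1 : 1 ≤ l)
    {D D' : Fin n → Fin (m+1) → ℝ} {z : MargIdx m d Ω → ℝ} {T : ℝ} (hT : 0 ≤ T)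
    (hz : ∀ p, |z p| ≤ T)
    (hD' : maxDistToMarginals Ω (fun p => margVec Ω D p + z p) D' ≤
      maxDistToMarginals Ω (fun p => margVec Ω D p + z p) D)
    (q : Finset (Fin (m+1))) (hq0 : q.Nonempty) (hq : q.card ≤ d) :
    margL1 Ω D D' q ≤ 2 * (l : ℝ) ^ d * T := by
  have hdist : maxDistToMarginals Ω (fun p => margVec Ω D p + z p) D ≤ (l : ℝ) ^ d * T := by
    refine csSup_le ⟨_, ⟨q, hq0, hq⟩, rfl⟩ ?_
    rintro r ⟨q, rfl⟩
    refine (Finset.sum_le_card_nsmul _ _ T fun t _ => ?_).trans ?_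
    · simpa [margVec] using hz ⟨q, t⟩
    · rw [nsmul_eq_mul, Finset.card_attach]
      gcongr
      exact_mod_cast card_pi_le hl hl1 q.2.2
  have h1 := (le_maxDistToMarginals (fun p => margVec Ω D p + z p) D ⟨q, hq0, hq⟩).trans hdist
  have h2 := (le_maxDistToMarginals (fun p => margVec Ω D p + z p) D' ⟨q, hq0, hq⟩).trans
    (hD'.trans hdist)
  have h3 : margL1 Ω D D' q ≤
      ∑ t ∈ (q.pi Ω).attach, (|(fun p => margVec Ω D p + z p) (⟨⟨q, hq0, hq⟩, t⟩ : MargIdx m d Ω) -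
          marginal D q t.1| +
        |(fun p => margVec Ω D p + z p) (⟨⟨q, hq0, hq⟩, t⟩ : MargIdx m d Ω) -
          marginal D' q t.1|) := by
    rw [margL1, ← Finset.sum_attach]
    refine Finset.sum_le_sum fun t _ => ?_
    rw [abs_sub_comm _ (marginal D q t.1)]
    exact abs_sub_le _ _ _
  rw [Finset.sum_add_distrib] at h3
  calc _ ≤ _ := h3
    _ ≤ (l : ℝ) ^ d * T + (l : ℝ) ^ d * T := add_le_add h1 h2
    _ = _ := by ring

end Mechanism

lemma one_sub_le_pi_gaussianReal {ι : Type*} [Fintype ι] {v : ℝ≥0} (hv : v ≠ 0) {T η : ℝ}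
    (hT : 0 ≤ T) (hη : Fintype.card ι * exp (-T ^ 2 / (2 * v)) ≤ η) :
    ENNReal.ofReal (1 - η) ≤
      (Measure.pi fun _ : ι => gaussianReal 0 v) {z | ∀ i, |z i| ≤ T} := by
  set μ := Measure.pi fun _ : ι => gaussianReal 0 v with hμ
  have h1 (i : ι) : μ {z | T < |z i|} ≤ ENNReal.ofReal (exp (-T ^ 2 / (2 * v))) := by
    have e : {z : ι → ℝ | T < |z i|} =
        Function.eval i ⁻¹' (Set.Ioi T ∪ (fun x => -x) ⁻¹' Set.Ioi T) := by
      ext z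
      simp [lt_abs, lt_neg]
    have hneg : gaussianReal 0 v ((fun x => -x) ⁻¹' Set.Ioi T) = gaussianReal 0 v (Set.Ioi T) := by
      rw [← Measure.map_apply (by fun_prop) measurableSet_Ioi, gaussianReal_map_neg, neg_zero]
    have hm : MeasurableSet (Set.Ioi T ∪ (fun x : ℝ => -x) ⁻¹' Set.Ioi T) :=
      measurableSet_Ioi.union (measurable_neg measurableSet_Ioi)
    rw [e, (measurePreserving_eval (fun _ : ι => gaussianReal 0 v) i).measure_preimage
      hm.nullMeasurableSet]
    refine (measure_union_le _ _).trans ?_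
    rw [hneg]
    refine (add_le_add (gaussianReal_Ioi_le_exp hv hT) (gaussianReal_Ioi_le_exp hv hT)).trans ?_
    rw [← ENNReal.ofReal_add (by positivity) (by positivity)]
    exact ENNReal.ofReal_le_ofReal (le_of_eq (by ring))
  have hA : MeasurableSet {z : ι → ℝ | ∀ i, |z i| ≤ T} := by
    have : {z : ι → ℝ | ∀ i, |z i| ≤ T} = ⋂ i, {z | |z i| ≤ T} := by ext z; simp
    rw [this]
    exact MeasurableSet.iInter fun i => measurableSet_le (by fun_prop) measurable_const
  have h2 : μ {z : ι → ℝ | ∀ i, |z i| ≤ T}ᶜ ≤ ENNReal.ofReal η := by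
    have : {z : ι → ℝ | ∀ i, |z i| ≤ T}ᶜ = ⋃ i, {z | T < |z i|} := by ext z; simp
    rw [this]
    refine (measure_iUnion_fintype_le _ _).trans ((Finset.sum_le_sum fun i _ => h1 i).trans ?_)
    rw [Finset.sum_const, nsmul_eq_mul, Finset.card_univ, ← ENNReal.ofReal_natCast,
      ← ENNReal.ofReal_mul (Nat.cast_nonneg _)]
    exact ENNReal.ofReal_le_ofReal hη
  have hη0 : 0 ≤ η := le_trans (by positivity) hη
  rw [ENNReal.ofReal_sub _ hη0, ENNReal.ofReal_one, tsub_le_iff_right,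
    ← prob_add_prob_compl (μ := μ) hA]
  gcongr

/-- end-to-end guarantee of the mechanism `Gen_{d,σ}` for
logistic regression: (a) `(ε,δ)`-DP; (b) excess empirical risk bound with
probability at least `1 − 2^{−λ}`. -/
theorem gen_mechanism_dp_and_excess_risk_logistic :
    ∃ C : ℝ, 0 < C ∧
      ∀ (m n d : ℕ), 1 ≤ m → 1 ≤ n → 2 ≤ d → d ≤ m + 1 →
      Fintype.card {q : Finset (Fin (m+1)) // q.Nonempty ∧ q.card ≤ d} ≤ m ^ d →
      ∀ (lam ε δ τ : ℝ), 0 < lam → ε ∈ Set.Ioo (0:ℝ) 1 → δ ∈ Set.Ioo (0:ℝ) 1 →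
        0 < τ → 1 ≤ τ * Real.sqrt m →
      ∀ (Ω : Fin (m+1) → Finset ℝ), ValidDomains m Ω →
      ∀ l : ℕ, l = (Finset.univ.sup fun j : Fin (m+1) => (Ω j).card) →
      ∀ σ : ℝ, σ = 2 * (m : ℝ) ^ ((d : ℝ) / 2) * Real.sqrt (Real.log (1.25 / δ)) / ε →
      ∀ sel : (MargIdx m d Ω → ℝ) → (Fin n → Fin (m+1) → ℝ),
        Measurable sel →
        (∀ h : MargIdx m d Ω → ℝ, ValidDataset Ω (sel h)) →
        (∀ (h : MargIdx m d Ω → ℝ) (D : Fin n → Fin (m+1) → ℝ), ValidDataset Ω D →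
          maxDistToMarginals Ω h (sel h) ≤ maxDistToMarginals Ω h D) →
      ∀ Dr : Fin n → Fin (m+1) → ℝ, ValidDataset Ω Dr →
      -- (a) differential privacy of the mechanism
      ((∀ Dr' : Fin n → Fin (m+1) → ℝ, ValidDataset Ω Dr' → Adjacent Dr Dr' →
        ∀ S : Set (Fin n → Fin (m+1) → ℝ), MeasurableSet S →
          Measure.map (fun z => sel (fun p => margVec Ω Dr p + z p)) (noiseMeasure m d Ω σ) S ≤
            ENNReal.ofReal (Real.exp ε) *
              Measure.map (fun z => sel (fun p => margVec Ω Dr' p + z p))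
                (noiseMeasure m d Ω σ) S + ENNReal.ofReal δ) ∧
      -- (b) excess empirical risk bound, with probability ≥ 1 − 2^{−λ}
      (∀ wr : EuclideanSpace ℝ (Fin m), ‖wr‖ ≤ τ →
        (∀ w : EuclideanSpace ℝ (Fin m), ‖w‖ ≤ τ →
          risk logisticLoss wr Dr ≤ risk logisticLoss w Dr) →
        ∀ wsel : (Fin n → Fin (m+1) → ℝ) → EuclideanSpace ℝ (Fin m),
          (∀ D : Fin n → Fin (m+1) → ℝ, ‖wsel D‖ ≤ τ ∧
            ∀ w : EuclideanSpace ℝ (Fin m), ‖w‖ ≤ τ →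
              risk logisticLoss (wsel D) D ≤ risk logisticLoss w D) →
          noiseMeasure m d Ω σ
              {z : MargIdx m d Ω → ℝ |
                |risk logisticLoss (wsel (sel (fun p => margVec Ω Dr p + z p))) Dr -
                    risk logisticLoss wr Dr| ≤
                  C * (τ ^ 2 * (m : ℝ) / ((d : ℝ) - 1) +
                    (1 / (n : ℝ)) * τ * Real.sqrt (m : ℝ) *
                      (3 * (m : ℝ) * max 1 τ) ^ (d - 1) *
                      (2 * (l : ℝ) ^ d *
                        Real.sqrt (2 * (Real.log 2 * (1 + lam) + (d : ℝ) * Real.log (m * l))) *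
                        σ))} ≥
            ENNReal.ofReal (1 - (2 : ℝ) ^ (-lam)))) := by
  refine ⟨4, by norm_num, ?_⟩
  intro m n d hm hn hd _ hQ lam ε δ τ hlam hε hδ hτ _ Ω hΩ l hl σ hσ sel hsel hselv hselmin Dr hDr
  have hm0 : (0 : ℝ) < m := by exact_mod_cast hm
  have hL := log_five_fourths_div_pos hδ
  have hσ0 : 0 < σ := by
    rw [hσ]
    have := hε.1
    positivity
  refine ⟨fun Dr' _ hadj S hS => ?_, fun wr hwr hwrmin wsel hwsel => ?_⟩
  · have hmeas (D : Fin n → Fin (m+1) → ℝ) :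
        Measurable fun z : MargIdx m d Ω → ℝ => sel (fun p => margVec Ω D p + z p) :=
      hsel.comp (by fun_prop)
    rw [Measure.map_apply (hmeas _) hS, Measure.map_apply (hmeas _) hS]
    refine gaussian_mechanism (margVec Ω Dr) (margVec Ω Dr') (Δ := √2 * (m : ℝ) ^ ((d : ℝ) / 2))
      hε hδ (by positivity) ?_ ?_ (hsel hS)
    · have h2 : √2 * √2 = (2 : ℝ) := mul_self_sqrt zero_le_two
      rw [hσ, sqrt_mul zero_le_two]
      congr 1
      linear_combination (-(m : ℝ) ^ ((d : ℝ) / 2) * √(log (1.25 / δ))) * h2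
    · refine (sum_sq_margVec_sub_le hadj).trans ?_
      rw [mul_pow, sq_sqrt zero_le_two, ← rpow_natCast, ← rpow_mul hm0.le]
      have : (d : ℝ) / 2 * ((2 : ℕ) : ℝ) = d := by push_cast; ring
      rw [this, rpow_natCast]
      gcongr
      exact_mod_cast hQ
  · have hl2 : 2 ≤ l := by
      have h1 : (Ω (Fin.last m)).card = 2 := by
        rw [hΩ.2]
        exact Finset.card_pair (by norm_num)
      rw [hl, ← h1]
      exact Finset.le_sup (f := fun j : Fin (m+1) => (Ω j).card) (Finset.mem_univ _)
    have hl1 : 1 ≤ l := by omega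
    have hml : (1 : ℝ) ≤ m * l := by exact_mod_cast Nat.mul_pos hm hl1
    set A := log 2 * (1 + lam) + (d : ℝ) * log (m * l) with hA
    have hA0 : 0 ≤ A := by
      have := log_nonneg hml
      have := log_nonneg (one_le_two (α := ℝ))
      positivity
    set T := √(2 * A) * σ with hTdef
    have hT0 : 0 ≤ T := by positivity
    set v := Real.toNNReal (σ ^ 2) with hvdef
    have hvσ : (v : ℝ) = σ ^ 2 := Real.coe_toNNReal _ (sq_nonneg σ)
    have hv : v ≠ 0 := by
      intro h
      rw [h, NNReal.coe_zero] at hvσ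
      exact (pow_pos hσ0 2).ne hvσ
    have hprob : (Fintype.card (MargIdx m d Ω) : ℝ) * exp (-T ^ 2 / (2 * v)) ≤
        (2 : ℝ) ^ (-lam) := by
      have e1 : -T ^ 2 / (2 * v) = -A := by
        rw [hvσ, hTdef, mul_pow, sq_sqrt (by positivity)]
        field_simp
      have e2 : exp (-A) = (2 : ℝ) ^ (-lam) / 2 / (m * l) ^ d := by
        rw [rpow_def_of_pos two_pos, hA]
        have : -(log 2 * (1 + lam) + (d : ℝ) * log (m * l)) =
            log 2 * -lam - log 2 - d * log (m * l) := by ring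
        rw [this, exp_sub, exp_sub, exp_log two_pos, exp_nat_mul, exp_log (by positivity)]
      have hcard : (Fintype.card (MargIdx m d Ω) : ℝ) ≤ (m * l) ^ d := by
        exact_mod_cast card_margIdx_le hl hl1 hQ
      have h2 : 0 < (2 : ℝ) ^ (-lam) := by positivity
      rw [e1, e2]
      calc _ ≤ ((m : ℝ) * l) ^ d * ((2 : ℝ) ^ (-lam) / 2 / (m * l) ^ d) := by gcongr
        _ = (2 : ℝ) ^ (-lam) / 2 := by field_simp
        _ ≤ _ := by linarith
    refine (one_sub_le_pi_gaussianReal hv hT0 hprob).trans (measure_mono fun z hz => ?_)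
    set Ds := sel (fun p => margVec Ω Dr p + z p) with hDs
    have hDsv : ValidDataset Ω Ds := hselv _
    have hE := margL1_sel_le hl hl1 hT0 hz (hselmin _ Dr hDr)
    set R := τ * √m with hR
    have hR0 : 0 < R := by positivity
    have hball (w : EuclideanSpace ℝ (Fin m)) (hw : ‖w‖ ≤ τ) : √m * ‖w‖ ≤ R := by
      rw [hR, mul_comm]
      gcongr
    have hη (w : EuclideanSpace ℝ (Fin m)) (hw : ‖w‖ ≤ τ) :=
      abs_le.1 (abs_risk_sub_risk_le (K := d - 1) hn hΩ hDr hDsv hE hR0 (hball w hw)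
        (by omega) (by omega))
    have h1 := hη _ (hwsel Ds).1
    have h2 := hη wr hwr
    have h3 := (hwsel Ds).2 wr hwr
    have h4 := hwrmin _ (hwsel Ds).1
    have hKcast : ((d - 1 : ℕ) : ℝ) = (d : ℝ) - 1 := by
      rw [Nat.cast_sub (by omega), Nat.cast_one]
    have hpow : (2 : ℝ) ^ (d - 1) ≤ (3 * m * max 1 τ) ^ (d - 1) := by
      gcongr
      have hm1 : (1 : ℝ) ≤ m := by exact_mod_cast hm
      nlinarith [le_max_left 1 τ]
    have hfin : 1 / (n : ℝ) * (R * 2 ^ (d - 1) * (2 * (l : ℝ) ^ d * T)) ≤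
        1 / (n : ℝ) * (R * (3 * m * max 1 τ) ^ (d - 1) * (2 * (l : ℝ) ^ d * T)) := by
      gcongr
    have hnn : 0 ≤ 1 / (n : ℝ) * (R * 2 ^ (d - 1) * (2 * (l : ℝ) ^ d * T)) := by positivity
    have hR2 : R ^ 2 = τ ^ 2 * m := by rw [hR, mul_pow, sq_sqrt hm0.le]
    rw [hKcast, hR2] at h1 h2
    have hgoal : 1 / (n : ℝ) * τ * √m * (3 * m * max 1 τ) ^ (d - 1) *
        (2 * (l : ℝ) ^ d * √(2 * A) * σ) =
        1 / (n : ℝ) * (R * (3 * m * max 1 τ) ^ (d - 1) * (2 * (l : ℝ) ^ d * T)) := by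
      rw [hR, hTdef]
      ring
    rw [Set.mem_ofPred_eq, hgoal, abs_of_nonneg (by linarith)]
    linarith
end
end

section
/- For every γ ∈ (0,1], the function φ(t) = γ·φ_γ(t) on [−1,1] is convex, Lipschitz with constant 2 + γ/2, and (γ/4)-strongly convex, i.e., t ↦ φ(t) − (γ/8)·t² is convex on [−1,1]. -/
noncomputable section
open Real

/-- The piecewise part `ψ_γ` of the lower-bound loss. -/
def psiGamma (γ t : ℝ) : ℝ :=
  if t ≤ 0 then 1 - 2 * t / γ
  else if t ≤ γ then (t - γ) ^ 2 / γ ^ 2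
  else 0

/-- `φ_γ(t) = (1−t)²/8 + ψ_γ(t)`. -/
def phiGamma (γ t : ℝ) : ℝ := (1 - t) ^ 2 / 8 + psiGamma γ t

/-- `γ ψ_γ` has at every point a subgradient in `[-2, 0]`. -/
theorem psiGamma_exists_subgradient {γ : ℝ} (hγ : 0 < γ) (x : ℝ) :
    ∃ s ∈ Set.Icc (-2 : ℝ) 0, ∀ y, γ * psiGamma γ x + s * (y - x) ≤ γ * psiGamma γ y := by
  have h_left (t : ℝ) : γ * (1 - 2 * t / γ) = γ - 2 * t := by field_simp
  have h_mid (t : ℝ) : γ * ((t - γ) ^ 2 / γ ^ 2) = (t - γ) ^ 2 / γ := by field_simp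
  simp only [psiGamma, mul_ite, h_left, h_mid, mul_zero]
  rcases le_or_gt x 0 with hx | hx
  · refine ⟨-2, by norm_num, fun y => ?_⟩
    rw [if_pos hx]
    split_ifs with h1 h2
    · linarith
    · rw [le_div_iff₀ hγ]; nlinarith [sq_nonneg y]
    · linarith
  rcases le_or_gt x γ with hx' | hx'
  · refine ⟨2 * (x - γ) / γ, ⟨?_, ?_⟩, fun y => ?_⟩
    · rw [le_div_iff₀ hγ]; linarith
    · exact div_nonpos_of_nonpos_of_nonneg (by linarith) hγ.le
    · rw [if_neg hx.not_ge, if_pos hx', div_mul_eq_mul_div, ← add_div, div_le_iff₀ hγ]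
      split_ifs with h1 h2
      · nlinarith [mul_nonneg hx.le (neg_nonneg.2 h1), sq_nonneg x]
      · rw [div_mul_cancel₀ _ hγ.ne']; nlinarith [sq_nonneg (y - x)]
      · nlinarith [mul_nonneg (sub_nonneg.2 hx') (sub_nonneg.2 (not_le.1 h2).le),
          sq_nonneg (x - γ)]
  · refine ⟨0, by norm_num, fun y => ?_⟩
    rw [if_neg hx.not_ge, if_neg hx'.not_ge, zero_mul, add_zero]
    split_ifs with h1 h2
    · linarith
    · positivity
    · exact le_rfl

theorem convexOn_mul_psiGamma {γ : ℝ} (hγ : 0 < γ) :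
    ConvexOn ℝ Set.univ (fun t => γ * psiGamma γ t) := by
  refine ⟨convex_univ, fun x _ y _ a b ha hb hab => ?_⟩
  obtain ⟨s, -, hs⟩ := psiGamma_exists_subgradient hγ (a • x + b • y)
  have hx := mul_le_mul_of_nonneg_left (hs x) ha
  have hy := mul_le_mul_of_nonneg_left (hs y) hb
  simp only [smul_eq_mul] at *
  obtain rfl : b = 1 - a := by linarith
  linarith

theorem abs_mul_psiGamma_sub_le {γ : ℝ} (hγ : 0 < γ) (x y : ℝ) :
    |γ * psiGamma γ x - γ * psiGamma γ y| ≤ 2 * |x - y| := by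
  have one_sided (u v : ℝ) : γ * psiGamma γ u - γ * psiGamma γ v ≤ 2 * |u - v| := by
    obtain ⟨s, ⟨hs, hs'⟩, h⟩ := psiGamma_exists_subgradient hγ u
    have hsabs : |s| ≤ 2 := abs_le.2 ⟨hs, by linarith⟩
    calc γ * psiGamma γ u - γ * psiGamma γ v ≤ s * (u - v) := by linarith [h v]
      _ ≤ |s| * |u - v| := by rw [← abs_mul]; exact le_abs_self _
      _ ≤ 2 * |u - v| := by gcongr
  exact abs_sub_le_iff.2 ⟨one_sided x y, abs_sub_comm x y ▸ one_sided y x⟩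

/-- `φ(t) = γ·φ_γ(t)` is convex, `(2+γ/2)`-Lipschitz and
`(γ/4)`-strongly convex on `[-1,1]`. -/
theorem phiGamma_convex_lipschitz_strongly_convex (γ : ℝ) (hγ : γ ∈ Set.Ioc (0:ℝ) 1) :
    ConvexOn ℝ (Set.Icc (-1 : ℝ) 1) (fun t => γ * phiGamma γ t) ∧
    LipschitzOnWith (Real.toNNReal (2 + γ / 2)) (fun t => γ * phiGamma γ t)
      (Set.Icc (-1 : ℝ) 1) ∧
    ConvexOn ℝ (Set.Icc (-1 : ℝ) 1)
      (fun t => γ * phiGamma γ t - γ / 8 * t ^ 2) := by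
  obtain ⟨hγ₀, -⟩ := hγ
  have h_strong : ConvexOn ℝ (Set.Icc (-1 : ℝ) 1)
      (fun t => γ * phiGamma γ t - γ / 8 * t ^ 2) := by
    refine ⟨convex_Icc _ _, fun x _ y _ a b ha hb hab => ?_⟩
    have h := (convexOn_mul_psiGamma hγ₀).2 (Set.mem_univ x) (Set.mem_univ y) ha hb hab
    simp only [phiGamma, smul_eq_mul] at h ⊢
    obtain rfl : b = 1 - a := by linarith
    linarith
  refine ⟨?_, ?_, h_strong⟩
  · have h_sq : ConvexOn ℝ (Set.Icc (-1 : ℝ) 1) (fun t => γ / 8 * t ^ 2) :=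
      ((even_two.convexOn_pow (𝕜 := ℝ)).subset (Set.subset_univ _) (convex_Icc _ _)).smul
        (by positivity)
    exact (h_strong.add h_sq).congr fun t _ => by simp
  · refine LipschitzOnWith.of_dist_le_mul fun x hx y hy => ?_
    rw [Real.coe_toNNReal _ (by positivity), Real.dist_eq, Real.dist_eq]
    have h_quad : |γ / 8 * (x + y - 2) * (x - y)| ≤ γ / 2 * |x - y| := by
      rw [abs_mul, abs_mul, abs_of_pos (by positivity : 0 < γ / 8)]
      have : |x + y - 2| ≤ 4 := abs_le.2 ⟨by linarith [hx.1, hy.1], by linarith [hx.2, hy.2]⟩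
      calc γ / 8 * |x + y - 2| * |x - y| ≤ γ / 8 * 4 * |x - y| := by gcongr
        _ = γ / 2 * |x - y| := by ring
    calc |γ * phiGamma γ x - γ * phiGamma γ y|
        = |γ / 8 * (x + y - 2) * (x - y) + (γ * psiGamma γ x - γ * psiGamma γ y)| := by
          simp only [phiGamma]; ring_nf
      _ ≤ γ / 2 * |x - y| + 2 * |x - y| :=
          (abs_add_le _ _).trans (add_le_add h_quad (abs_mul_psiGamma_sub_le hγ₀ x y))
      _ = (2 + γ / 2) * |x - y| := by ring
end
end

section
/- For every γ ∈ (0,1] and every integer d ≥ 1, the degree-d Bernstein polynomial P_dφ of the function φ(t) = γ·φ_γ(t) on the interval [−1,1] satisfies sup_{t∈[−1,1]} |P_dφ(t) − φ(t)| ≤ (5 + (5/4)·γ)/√d; in particular, sup_{t∈[−1,1]} |P_dφ(t) − φ(t)| ≤ 25/(4·√d). -/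
noncomputable section
open Real Finset

/-- The degree-`d` Bernstein polynomial of `f` on `[a,b]`. -/
def bernsteinPoly (f : ℝ → ℝ) (a b : ℝ) (d : ℕ) (x : ℝ) : ℝ :=
  ∑ i ∈ Finset.range (d + 1),
    f (a + (i : ℝ) * (b - a) / (d : ℝ)) * (d.choose i : ℝ) *
      ((x - a) / (b - a)) ^ i * (1 - (x - a) / (b - a)) ^ (d - i)

lemma sum_bernstein_weights (d : ℕ) (x : ℝ) :
    ∑ i ∈ Finset.range (d + 1), (d.choose i : ℝ) * x ^ i * (1 - x) ^ (d - i) = 1 := by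
  have h := congrArg (Polynomial.eval x) (bernsteinPolynomial.sum ℝ d)
  simpa [Polynomial.eval_finsetSum, bernsteinPolynomial] using h

lemma sum_sq_bernstein_weights (d : ℕ) (x : ℝ) :
    ∑ i ∈ Finset.range (d + 1),
      (d * x - i) ^ 2 * ((d.choose i : ℝ) * x ^ i * (1 - x) ^ (d - i)) = d * x * (1 - x) := by
  have h := congrArg (Polynomial.eval x) (bernsteinPolynomial.variance ℝ d)
  simpa [Polynomial.eval_finsetSum, bernsteinPolynomial] using h

/-- A function that is `L`-Lipschitz on `[-1,1]` is approximated by its Bernstein polynomial of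
degree `d` with error at most `L / √d`. -/
lemma abs_bernsteinPoly_sub_le {f : ℝ → ℝ} {L : ℝ} (hL : 0 ≤ L)
    (hf : ∀ s ∈ Set.Icc (-1 : ℝ) 1, ∀ t ∈ Set.Icc (-1 : ℝ) 1, |f s - f t| ≤ L * |s - t|)
    {d : ℕ} (hd : 1 ≤ d) {t : ℝ} (ht : t ∈ Set.Icc (-1 : ℝ) 1) :
    |bernsteinPoly f (-1) 1 d t - f t| ≤ L / Real.sqrt d := by
  obtain ⟨ht₀, ht₁⟩ := ht
  have hd₀ : (0 : ℝ) < d := by exact_mod_cast hd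
  set x : ℝ := (t - -1) / (1 - -1) with hx
  have htx : t = 2 * x - 1 := by rw [hx]; ring
  have hx₀ : 0 ≤ x := by linarith
  have hx₁ : 0 ≤ 1 - x := by linarith
  set w : ℕ → ℝ := fun i => (d.choose i : ℝ) * x ^ i * (1 - x) ^ (d - i) with hw
  have hw₀ : ∀ i, 0 ≤ w i := fun i => by positivity
  have hw₁ : ∑ i ∈ Finset.range (d + 1), w i = 1 := sum_bernstein_weights d x
  have hw₂ : ∑ i ∈ Finset.range (d + 1), (d * x - i) ^ 2 * w i = d * x * (1 - x) :=
    sum_sq_bernstein_weights d x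
  set r := Real.sqrt d with hr
  have hr₀ : 0 < r := Real.sqrt_pos.2 hd₀
  have hrd : r ^ 2 = d := Real.sq_sqrt hd₀.le
  have hsum : bernsteinPoly f (-1) 1 d t - f t =
      ∑ i ∈ Finset.range (d + 1), (f (-1 + (i : ℝ) * (1 - -1) / d) - f t) * w i := by
    simp only [sub_mul, Finset.sum_sub_distrib, ← Finset.mul_sum, hw₁, mul_one]
    congr 1
    refine Finset.sum_congr rfl fun i _ => ?_
    simp only [hw]
    ring
  have hterm : ∀ i ∈ Finset.range (d + 1),
      |(f (-1 + (i : ℝ) * (1 - -1) / d) - f t) * w i| ≤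
        L * (1 / (2 * r) * w i + 2 / (r * d) * ((d * x - i) ^ 2 * w i)) := by
    intro i hi
    have hid : (i : ℝ) ≤ d := by
      exact_mod_cast Nat.lt_succ_iff.1 (Finset.mem_range.1 hi)
    have hle : (i : ℝ) / d ≤ 1 := (div_le_one hd₀).2 hid
    have hge : 0 ≤ (i : ℝ) / d := by positivity
    set y : ℝ := -1 + (i : ℝ) * (1 - -1) / d with hy
    have hyi : y = 2 * ((i : ℝ) / d) - 1 := by rw [hy]; ring
    have h := hf y ⟨by linarith, by linarith⟩ t ⟨ht₀, ht₁⟩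
    have hyt : |y - t| ≤ 1 / (2 * r) + 2 / (r * d) * (d * x - i) ^ 2 := by
      have hsq : 1 / (2 * r) + 2 / (r * d) * (d * x - i) ^ 2 =
          (1 + (r * |y - t|) ^ 2) / (2 * r) := by
        rw [mul_pow, sq_abs, hyi, htx, hrd]
        field_simp
        ring
      rw [hsq, le_div_iff₀ (by positivity)]
      nlinarith [sq_nonneg (r * |y - t| - 1)]
    rw [abs_mul, abs_of_nonneg (hw₀ i)]
    calc |f y - f t| * w i
        ≤ (L * (1 / (2 * r) + 2 / (r * d) * (d * x - i) ^ 2)) * w i :=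
          mul_le_mul_of_nonneg_right (h.trans (mul_le_mul_of_nonneg_left hyt hL)) (hw₀ i)
      _ = _ := by ring
  rw [hsum]
  refine (Finset.abs_sum_le_sum_abs _ _).trans ((Finset.sum_le_sum hterm).trans ?_)
  rw [← Finset.mul_sum, Finset.sum_add_distrib, ← Finset.mul_sum, ← Finset.mul_sum, hw₁, hw₂,
    div_eq_mul_one_div L r]
  refine mul_le_mul_of_nonneg_left ?_ hL
  have hvar : 1 / (2 * r) * 1 + 2 / (r * d) * (d * x * (1 - x)) =
      (1 / 2 + 2 * (x * (1 - x))) / r := by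
    field_simp
  rw [hvar]
  gcongr
  nlinarith [sq_nonneg (2 * x - 1)]

lemma mul_psiGamma_sub_mem_Icc {γ s t : ℝ} (hγ : 0 < γ) (hst : s ≤ t) :
    γ * psiGamma γ s - γ * psiGamma γ t ∈ Set.Icc 0 (2 * (t - s)) := by
  have hlin : ∀ u, γ * (1 - 2 * u / γ) = γ - 2 * u := fun u => by field_simp
  have hquad : ∀ u, γ * ((u - γ) ^ 2 / γ ^ 2) = u ^ 2 / γ - 2 * u + γ := fun u => by
    field_simp
    ring
  unfold psiGamma
  split_ifs with hs ht htγ hsγ ht htγ ht htγ <;>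
    simp only [hlin, hquad, mul_zero, Set.mem_Icc] <;> try (constructor <;> linarith)
  · have h₀ : 0 ≤ t ^ 2 / γ := by positivity
    have h₁ : t ^ 2 / γ ≤ t := by rw [div_le_iff₀ hγ]; nlinarith
    constructor <;> linarith
  · have h₀ : s ^ 2 / γ ≤ t ^ 2 / γ := by gcongr; linarith
    have h₁ : t ^ 2 / γ - s ^ 2 / γ ≤ 2 * (t - s) := by
      rw [← sub_div, div_le_iff₀ hγ]; nlinarith
    constructor <;> linarith
  · have h : s ^ 2 / γ - 2 * s + γ = (γ - s) ^ 2 / γ := by field_simp; ring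
    have h₀ : 0 ≤ (γ - s) ^ 2 / γ := by positivity
    have h₁ : (γ - s) ^ 2 / γ ≤ γ - s := by rw [div_le_iff₀ hγ]; nlinarith
    constructor <;> linarith

lemma abs_mul_phiGamma_sub_le {γ s t : ℝ} (hγ : 0 < γ)
    (hs : s ∈ Set.Icc (-1 : ℝ) 1) (ht : t ∈ Set.Icc (-1 : ℝ) 1) :
    |γ * phiGamma γ s - γ * phiGamma γ t| ≤ (2 + γ / 2) * |s - t| := by
  wlog hst : s ≤ t generalizing s t
  · rw [abs_sub_comm, abs_sub_comm s]
    exact this ht hs (le_of_not_ge hst)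
  obtain ⟨h₀, h₁⟩ := mul_psiGamma_sub_mem_Icc hγ hst
  obtain ⟨hs₀, hs₁⟩ := hs
  obtain ⟨ht₀, ht₁⟩ := ht
  have hsq : (1 - s) ^ 2 / 8 - (1 - t) ^ 2 / 8 ≤ (t - s) / 2 := by nlinarith
  have hsq₀ : 0 ≤ (1 - s) ^ 2 / 8 - (1 - t) ^ 2 / 8 := by nlinarith
  have hm := mul_le_mul_of_nonneg_left hsq hγ.le
  have hm₀ := mul_nonneg hγ.le hsq₀
  rw [abs_sub_comm s, abs_of_nonneg (sub_nonneg.2 hst), abs_of_nonneg] <;>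
    unfold phiGamma <;> linarith

/-- Bernstein approximation error for `φ(t) = γ·φ_γ(t)` on
`[-1,1]`. -/
theorem bernstein_error_phiGamma (γ : ℝ) (hγ : γ ∈ Set.Ioc (0:ℝ) 1) (d : ℕ) (hd : 1 ≤ d) :
    (∀ t ∈ Set.Icc (-1 : ℝ) 1,
      |bernsteinPoly (fun s => γ * phiGamma γ s) (-1) 1 d t - γ * phiGamma γ t| ≤
        (5 + 5 / 4 * γ) / Real.sqrt d) ∧
    (∀ t ∈ Set.Icc (-1 : ℝ) 1,
      |bernsteinPoly (fun s => γ * phiGamma γ s) (-1) 1 d t - γ * phiGamma γ t| ≤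
        25 / (4 * Real.sqrt d)) := by
  have hγ₀ := hγ.1
  have hγ₁ := hγ.2
  have h : ∀ t ∈ Set.Icc (-1 : ℝ) 1,
      |bernsteinPoly (fun s => γ * phiGamma γ s) (-1) 1 d t - γ * phiGamma γ t| ≤
        (2 + γ / 2) / Real.sqrt d := fun t ht =>
    abs_bernsteinPoly_sub_le (f := fun s => γ * phiGamma γ s) (by linarith)
      (fun _ hs _ ht => abs_mul_phiGamma_sub_le hγ₀ hs ht) hd ht
  refine ⟨fun t ht => (h t ht).trans ?_, fun t ht => (h t ht).trans ?_⟩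
  · gcongr <;> linarith
  · rw [← div_div]
    gcongr
    linarith
end
end
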